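/- arXiv:1701.04336 — 2 statements merged into one kernel-verified Lean document; each statement's English description precedes it below -/
import Mathlib

section
/- Let n ≥ 3. Let V := ℝ^{n+1} ⊗_ℝ ℝ⁴ (the real vector space underlying ℍ^{1,n}), on which a matrix g ∈ O(1,n) acts by g ⊗ id. If α : V × V × V → ℝ is an ℝ-trilinear form which is SO⁰(1,n)-invariant, i.e. α((g⊗id)x, (g⊗id)y, (g⊗id)z) = α(x,y,z) for all g ∈ SO⁰(1,n) and all x, y, z ∈ V, then α = 0. -/
open scoped TensorProduct Matrix

/-- The Minkowski form matrix `η = diag(−1,1,…,1)` of signature `(1,n)`. -/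
def lorentzEta (n : ℕ) : Matrix (Fin (n + 1)) (Fin (n + 1)) ℝ :=
  Matrix.diagonal (fun i => if i = 0 then (-1 : ℝ) else 1)

/-- The indefinite orthogonal group `O(1,n)`, as a set of matrices. -/
def lorentzO (n : ℕ) : Set (Matrix (Fin (n + 1)) (Fin (n + 1)) ℝ) :=
  {g | gᵀ * lorentzEta n * g = lorentzEta n}

/-- `SO⁰(1,n)`: the connected component of the identity in `O(1,n)`. -/
def lorentzSO0 (n : ℕ) : Set (Matrix (Fin (n + 1)) (Fin (n + 1)) ℝ) :=
  connectedComponentIn (lorentzO n) 1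

/-- The action of a matrix `g` on `V = ℝ^{n+1} ⊗ ℝ⁴` by `g ⊗ id`. -/
noncomputable def actV (n : ℕ) (g : Matrix (Fin (n + 1)) (Fin (n + 1)) ℝ) :
    ((Fin (n + 1) → ℝ) ⊗[ℝ] (Fin 4 → ℝ)) →ₗ[ℝ] ((Fin (n + 1) → ℝ) ⊗[ℝ] (Fin 4 → ℝ)) :=
  LinearMap.rTensor (Fin 4 → ℝ) (Matrix.toLin' g)

/-- The diagonal entries of the Minkowski form. -/
def lorentzSign {n : ℕ} (i : Fin (n + 1)) : ℝ := if i = 0 then -1 else 1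

lemma lorentzSign_mul_self {n : ℕ} (i : Fin (n + 1)) : lorentzSign i * lorentzSign i = 1 := by
  unfold lorentzSign; split_ifs <;> norm_num

/-- The rotation or boost in the coordinate plane spanned by `e_a` and `e_i`, with parameters
`c, s` playing the roles of `cos, sin` or `cosh, sinh`. -/
def planeTransform {n : ℕ} (a i : Fin (n + 1)) (c s : ℝ) :
    Matrix (Fin (n + 1)) (Fin (n + 1)) ℝ :=
  1 + Matrix.single a a (c - 1) + Matrix.single i i (c - 1) + Matrix.single i a s
    + Matrix.single a i (-(lorentzSign a * lorentzSign i) * s)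

lemma planeTransform_one_zero {n : ℕ} (a i : Fin (n + 1)) :
    planeTransform a i 1 0 = 1 := by
  simp [planeTransform]

lemma planeTransform_mem_lorentzO {n : ℕ} {a i : Fin (n + 1)} (h : a ≠ i) {c s : ℝ}
    (hcs : c ^ 2 + lorentzSign a * lorentzSign i * s ^ 2 = 1) :
    planeTransform a i c s ∈ lorentzO n := by
  have hη : lorentzEta n = Matrix.diagonal lorentzSign := rfl
  have ha := lorentzSign_mul_self a
  have hi := lorentzSign_mul_self i
  rw [lorentzO, Set.mem_ofPred_eq, hη]
  simp only [planeTransform, Matrix.transpose_add, Matrix.transpose_one, Matrix.transpose_single,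
    Matrix.add_mul, Matrix.mul_add, Matrix.one_mul, Matrix.mul_one, Matrix.single_mul_mul_single,
    Matrix.diagonal_apply, h, h.symm, if_true, if_false]
  ext p q
  simp only [Matrix.add_apply, Matrix.mul_diagonal, Matrix.diagonal_mul, Matrix.single_apply,
    Matrix.diagonal_apply]
  by_cases hpa : a = p <;> by_cases hpi : i = p <;> by_cases hqa : a = q <;>
    by_cases hqi : i = q <;> simp_all <;> grind

lemma planeTransform_mulVec_left {n : ℕ} {a i : Fin (n + 1)} (h : a ≠ i) (c s : ℝ) :
    planeTransform a i c s *ᵥ Pi.single a 1 = c • Pi.single a 1 + s • Pi.single i 1 := by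
  ext r
  by_cases hra : r = a <;> by_cases hri : r = i <;>
    simp_all [planeTransform, Matrix.one_apply, Matrix.single_apply, eq_comm]

lemma planeTransform_mulVec_right {n : ℕ} {a i : Fin (n + 1)} (h : a ≠ i) (c s : ℝ) :
    planeTransform a i c s *ᵥ Pi.single i 1 =
      c • Pi.single i 1 + (-(lorentzSign a * lorentzSign i) * s) • Pi.single a 1 := by
  ext r
  by_cases hra : r = a <;> by_cases hri : r = i <;>
    simp_all [planeTransform, Matrix.single_apply, eq_comm]

lemma planeTransform_mulVec_of_ne {n : ℕ} {a i j : Fin (n + 1)} (ha : j ≠ a) (hi : j ≠ i)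
    (c s : ℝ) : planeTransform a i c s *ᵥ Pi.single j 1 = Pi.single j 1 := by
  ext r
  simp [planeTransform, Matrix.one_apply, Pi.single_apply, ha.symm, hi.symm]

/-- A one-parameter curve `(c, s)` on the conic `c² + κ s² = 1` through `(1, 0)`. -/
lemma exists_conic_curve {κ : ℝ} (hκ : κ * κ = 1) : ∃ c s : ℝ → ℝ, Continuous c ∧ Continuous s ∧
    c 0 = 1 ∧ s 0 = 0 ∧ (∀ t, c t ^ 2 + κ * s t ^ 2 = 1) ∧
    (∀ t, c (-t) = c t) ∧ (∀ t, s (-t) = -s t) ∧ c 1 ≠ 0 ∧ s 1 ≠ 0 := by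
  rcases mul_self_eq_one_iff.mp hκ with rfl | rfl
  · refine ⟨Real.cos, Real.sin, Real.continuous_cos, Real.continuous_sin, Real.cos_zero,
      Real.sin_zero, fun t => ?_, Real.cos_neg, Real.sin_neg, Real.cos_one_pos.ne',
      (Real.sin_pos_of_pos_of_le_one one_pos le_rfl).ne'⟩
    linarith [Real.sin_sq_add_cos_sq t]
  · refine ⟨Real.cosh, Real.sinh, Real.continuous_cosh, Real.continuous_sinh, Real.cosh_zero,
      Real.sinh_zero, fun t => ?_, Real.cosh_neg, Real.sinh_neg, (Real.cosh_pos 1).ne',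
      (Real.sinh_pos_iff.mpr one_pos).ne'⟩
    linarith [Real.cosh_sq t]

/-- Each coordinate plane carries a rotation or boost of `SO⁰(1,n)` with nonzero parameters whose
inverse lies in `SO⁰(1,n)` too. -/
lemma exists_planeTransform_mem_lorentzSO0 {n : ℕ} {a i : Fin (n + 1)} (h : a ≠ i) :
    ∃ c s : ℝ, c ≠ 0 ∧ s ≠ 0 ∧ planeTransform a i c s ∈ lorentzSO0 n ∧
      planeTransform a i c (-s) ∈ lorentzSO0 n := by
  have hκ : lorentzSign a * lorentzSign i * (lorentzSign a * lorentzSign i) = 1 := by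
    rw [mul_mul_mul_comm, lorentzSign_mul_self, lorentzSign_mul_self, one_mul]
  obtain ⟨c, s, hc, hs, hc0, hs0, hcs, hcn, hsn, hc1, hs1⟩ := exists_conic_curve hκ
  have hcont : Continuous fun t => planeTransform a i (c t) (s t) := by
    refine continuous_matrix fun p q => ?_
    simp only [planeTransform, Matrix.add_apply, Matrix.single_apply]
    split_ifs <;> fun_prop
  have hmem : ∀ t, planeTransform a i (c t) (s t) ∈ lorentzSO0 n := fun t =>
    (isPreconnected_range hcont).subset_connectedComponentIn
      ⟨0, by simp only [hc0, hs0, planeTransform_one_zero]⟩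
      (Set.range_subset_iff.mpr fun t => planeTransform_mem_lorentzO h (hcs t)) ⟨t, rfl⟩
  exact ⟨c 1, s 1, hc1, hs1, hmem 1, by simpa only [hcn, hsn] using hmem (-1)⟩

/-- For `n ≥ 3`, every `SO⁰(1,n)`-invariant trilinear form on `ℝ^{n+1}` vanishes on the standard
basis. -/
lemma trilinear_invariant_single_eq_zero {n : ℕ} (hn : 3 ≤ n)
    (T : (Fin (n + 1) → ℝ) →ₗ[ℝ] (Fin (n + 1) → ℝ) →ₗ[ℝ] (Fin (n + 1) → ℝ) →ₗ[ℝ] ℝ)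
    (hT : ∀ g ∈ lorentzSO0 n, ∀ x y z, T (g *ᵥ x) (g *ᵥ y) (g *ᵥ z) = T x y z)
    (i j k : Fin (n + 1)) :
    T (Pi.single i 1) (Pi.single j 1) (Pi.single k 1) = 0 := by
  have hfresh : ∀ i j k : Fin (n + 1), ∃ a, a ≠ i ∧ a ≠ j ∧ a ≠ k := fun i j k => by
    have hlt : ({i, j, k} : Finset (Fin (n + 1))).card < Fintype.card (Fin (n + 1)) :=
      (Finset.card_le_three).trans_lt (by simp; omega)
    obtain ⟨a, ha⟩ := Finset.exists_mem_notMem_of_card_lt_card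
      (s := {i, j, k}) (t := Finset.univ) (by simpa using hlt)
    exact ⟨a, by simpa using ha.2⟩
  have h₁ : ∀ i j k : Fin (n + 1), i ≠ j → i ≠ k →
      T (Pi.single i 1) (Pi.single j 1) (Pi.single k 1) = 0 := fun i j k hij hik => by
    obtain ⟨a, hai, haj, hak⟩ := hfresh i j k
    obtain ⟨c, s, -, hs, hg, hg'⟩ := exists_planeTransform_mem_lorentzSO0 hai
    have e := hT _ hg (Pi.single a 1) (Pi.single j 1) (Pi.single k 1)
    have e' := hT _ hg' (Pi.single a 1) (Pi.single j 1) (Pi.single k 1)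
    simp only [planeTransform_mulVec_left hai, planeTransform_mulVec_of_ne haj.symm hij.symm,
      planeTransform_mulVec_of_ne hak.symm hik.symm, map_add, map_smul, LinearMap.add_apply,
      LinearMap.smul_apply, smul_eq_mul] at e e'
    exact (mul_eq_zero.mp (by linarith)).resolve_left hs
  have h₂ : ∀ i j k : Fin (n + 1), j ≠ i → j ≠ k →
      T (Pi.single i 1) (Pi.single j 1) (Pi.single k 1) = 0 := fun i j k hji hjk => by
    obtain ⟨a, haj, hai, hak⟩ := hfresh j i k
    obtain ⟨c, s, -, hs, hg, hg'⟩ := exists_planeTransform_mem_lorentzSO0 haj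
    have e := hT _ hg (Pi.single i 1) (Pi.single a 1) (Pi.single k 1)
    have e' := hT _ hg' (Pi.single i 1) (Pi.single a 1) (Pi.single k 1)
    simp only [planeTransform_mulVec_left haj, planeTransform_mulVec_of_ne hai.symm hji.symm,
      planeTransform_mulVec_of_ne hak.symm hjk.symm, map_add, map_smul, LinearMap.add_apply,
      LinearMap.smul_apply, smul_eq_mul] at e e'
    exact (mul_eq_zero.mp (by linarith)).resolve_left hs
  have h₃ : ∀ i j k : Fin (n + 1), k ≠ i → k ≠ j →
      T (Pi.single i 1) (Pi.single j 1) (Pi.single k 1) = 0 := fun i j k hki hkj => by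
    obtain ⟨a, hak, hai, haj⟩ := hfresh k i j
    obtain ⟨c, s, -, hs, hg, hg'⟩ := exists_planeTransform_mem_lorentzSO0 hak
    have e := hT _ hg (Pi.single i 1) (Pi.single j 1) (Pi.single a 1)
    have e' := hT _ hg' (Pi.single i 1) (Pi.single j 1) (Pi.single a 1)
    simp only [planeTransform_mulVec_left hak, planeTransform_mulVec_of_ne hai.symm hki.symm,
      planeTransform_mulVec_of_ne haj.symm hkj.symm, map_add, map_smul,
      smul_eq_mul] at e e'
    exact (mul_eq_zero.mp (by linarith)).resolve_left hs
  by_cases hij : i = j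
  · by_cases hjk : j = k
    · subst hij hjk
      obtain ⟨a, hai, -, -⟩ := hfresh i i i
      obtain ⟨c, s, hc, hs, hg, hg'⟩ := exists_planeTransform_mem_lorentzSO0 hai
      have e := hT _ hg (Pi.single a 1) (Pi.single i 1) (Pi.single i 1)
      have e' := hT _ hg' (Pi.single a 1) (Pi.single i 1) (Pi.single i 1)
      simp only [planeTransform_mulVec_left hai, planeTransform_mulVec_right hai, map_add,
        map_smul, LinearMap.add_apply, LinearMap.smul_apply, smul_eq_mul,
        h₁ a i i hai hai, h₁ i a a hai.symm hai.symm, h₂ a i a hai.symm hai.symm,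
        h₂ i a i hai hai, h₃ a a i hai.symm hai.symm, h₃ i i a hai hai] at e e'
      have hsc : s * c ^ 2 * T (Pi.single i 1) (Pi.single i 1) (Pi.single i 1) = 0 := by
        linear_combination (e - e') / 2
      exact (mul_eq_zero.mp hsc).resolve_left (mul_ne_zero hs (pow_ne_zero 2 hc))
    · subst hij
      exact h₃ _ _ _ (Ne.symm hjk) (Ne.symm hjk)
  · by_cases hik : i = k
    · subst hik
      exact h₂ _ _ _ (Ne.symm hij) (Ne.symm hij)
    · exact h₁ _ _ _ hij hik

/-- For `n ≥ 3`, every `SO⁰(1,n)`-invariant trilinear form on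
`V = ℝ^{n+1} ⊗ ℝ⁴` (the real vector space underlying `ℍ^{1,n}`), where `g` acts
by `g ⊗ id`, vanishes. -/
theorem trilinear_invariant_vanishes (n : ℕ) (hn : 3 ≤ n)
    (α : ((Fin (n + 1) → ℝ) ⊗[ℝ] (Fin 4 → ℝ)) →ₗ[ℝ]
      ((Fin (n + 1) → ℝ) ⊗[ℝ] (Fin 4 → ℝ)) →ₗ[ℝ]
      ((Fin (n + 1) → ℝ) ⊗[ℝ] (Fin 4 → ℝ)) →ₗ[ℝ] ℝ)
    (hα : ∀ g ∈ lorentzSO0 n, ∀ x y z,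
      α (actV n g x) (actV n g y) (actV n g z) = α x y z) :
    α = 0 := by
  let B := (Pi.basisFun ℝ (Fin (n + 1))).tensorProduct (Pi.basisFun ℝ (Fin 4))
  refine B.ext fun x => B.ext fun y => B.ext fun z => ?_
  obtain ⟨i, p⟩ := x
  obtain ⟨j, q⟩ := y
  obtain ⟨k, r⟩ := z
  let ι (p : Fin 4) := (TensorProduct.mk ℝ (Fin (n + 1) → ℝ) (Fin 4 → ℝ)).flip (Pi.single p 1)
  let T := (α.compl₁₂ (ι p) (ι q)).compr₂ (LinearMap.lcomp ℝ ℝ (ι r))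
  simp only [B, Module.Basis.tensorProduct_apply, Pi.basisFun_apply, LinearMap.zero_apply]
  exact trilinear_invariant_single_eq_zero hn T
    (fun g hg x y z => hα g hg (ι p x) (ι q y) (ι r z)) i j k
end

section
/- Let n ≥ 3. Let V := ℝ^{n+1} ⊗_ℝ ℝ⁴ (the real vector space underlying ℍ^{1,n}), on which a matrix g ∈ O(1,n) acts by g ⊗ id. If β : V × V → V is an ℝ-bilinear map which is SO⁰(1,n)-equivariant, i.e. β((g⊗id)x, (g⊗id)y) = (g⊗id)β(x,y) for all g ∈ SO⁰(1,n) and all x, y ∈ V, then β = 0. -/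
open scoped TensorProduct Matrix

/-- The matrix which equals the identity except on the coordinate plane `(a, b)`, where it acts
by the block `!![p, y; z, p]`. -/
def planeMatrix {ι : Type*} [DecidableEq ι] (a b : ι) (p y z : ℝ) : Matrix ι ι ℝ :=
  Matrix.of fun k i =>
    if i = a then (if k = a then p else 0) + (if k = b then z else 0)
    else if i = b then (if k = a then y else 0) + (if k = b then p else 0)
    else if k = i then 1 else 0

section PlaneMatrix

variable {ι : Type*} [DecidableEq ι] {a b : ι}

lemma planeMatrix_one_zero_zero (hab : a ≠ b) : planeMatrix a b 1 0 0 = 1 := by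
  ext k i
  simp only [planeMatrix, Matrix.of_apply, Matrix.one_apply]
  split_ifs <;> simp_all

lemma continuous_planeMatrix {X : Type*} [TopologicalSpace X] (a b : ι) {p y z : X → ℝ}
    (hp : Continuous p) (hy : Continuous y) (hz : Continuous z) :
    Continuous fun t => planeMatrix a b (p t) (y t) (z t) := by
  refine continuous_matrix fun k i => ?_
  simp only [planeMatrix, Matrix.of_apply]
  split_ifs <;> fun_prop

variable [Fintype ι]

lemma planeMatrix_mulVec_single_left (p y z : ℝ) :
    planeMatrix a b p y z *ᵥ Pi.single a 1 = p • Pi.single a 1 + z • Pi.single b 1 := by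
  ext k
  simp [planeMatrix, Pi.single_apply]

lemma planeMatrix_mulVec_single_right (hab : a ≠ b) (p y z : ℝ) :
    planeMatrix a b p y z *ᵥ Pi.single b 1 = y • Pi.single a 1 + p • Pi.single b 1 := by
  ext k
  simp [planeMatrix, Pi.single_apply, hab.symm]

lemma planeMatrix_mulVec_single_of_ne (p y z : ℝ) {i : ι} (hia : i ≠ a) (hib : i ≠ b) :
    planeMatrix a b p y z *ᵥ Pi.single i 1 = Pi.single i 1 := by
  ext k
  simp [planeMatrix, Pi.single_apply, hia, hib]

lemma planeMatrix_mulVec_apply (hab : a ≠ b) (p y z : ℝ) (v : ι → ℝ) (k : ι) :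
    (planeMatrix a b p y z *ᵥ v) k =
      if k = a then p * v a + y * v b else if k = b then z * v a + p * v b else v k := by
  have key : ∀ i, planeMatrix a b p y z k i * v i =
      (if i = a then ((if k = a then p else 0) + (if k = b then z else 0)) * v a else 0) +
      (if i = b then ((if k = a then y else 0) + (if k = b then p else 0)) * v b else 0) +
      (if i = k then (if k = a ∨ k = b then 0 else v k) else 0) := by
    intro i
    simp only [planeMatrix, Matrix.of_apply]
    by_cases hia : i = a
    · subst hia
      by_cases hk : i = k
      · subst hk
        simp [hab]
      · simp [hab, hk]
    by_cases hib : i = b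
    · subst hib
      by_cases hk : i = k
      · subst hk
        simp [hia]
      · simp [hia, hk]
    by_cases hk : i = k
    · subst hk
      simp [hia, hib]
    · simp [hia, hib, hk, Ne.symm hk]
  simp only [Matrix.mulVec, dotProduct, key, Finset.sum_add_distrib, Finset.sum_ite_eq',
    Finset.mem_univ, if_true]
  split_ifs <;> simp_all

lemma planeMatrix_transpose_mul_diagonal_mul (hab : a ≠ b) (d : ι → ℝ) {p y z : ℝ}
    (ha : p ^ 2 * d a + z ^ 2 * d b = d a) (hb : y ^ 2 * d a + p ^ 2 * d b = d b)
    (h : p * (y * d a + z * d b) = 0) :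
    (planeMatrix a b p y z)ᵀ * Matrix.diagonal d * planeMatrix a b p y z =
      Matrix.diagonal d := by
  have hcol : ∀ j, (fun k => planeMatrix a b p y z k j) =
      planeMatrix a b p y z *ᵥ Pi.single j 1 := fun j => by simp [Matrix.col_def]; rfl
  ext i j
  have e : ((planeMatrix a b p y z)ᵀ * Matrix.diagonal d * planeMatrix a b p y z) i j =
      ((fun k => planeMatrix a b p y z k i) ⬝ᵥ
        (fun k => d k * (fun k => planeMatrix a b p y z k j) k)) := by
    rw [Matrix.mul_apply]
    simp only [Matrix.mul_diagonal, dotProduct, Matrix.transpose_apply, mul_assoc]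
  rw [e, hcol, hcol]
  have hba := hab.symm
  have col : ∀ i, i = a ∨ i = b ∨ (i ≠ a ∧ i ≠ b) := fun i => by tauto
  rcases col i with rfl | rfl | ⟨hia, hib⟩ <;> rcases col j with rfl | rfl | ⟨hja, hjb⟩ <;>
    simp only [planeMatrix_mulVec_single_left, planeMatrix_mulVec_single_right,
      planeMatrix_mulVec_single_of_ne, ne_eq, not_false_eq_true, add_dotProduct, smul_dotProduct,
      single_dotProduct, *] <;>
    simp [Pi.single_apply, Matrix.diagonal_apply, *]
  all_goals first | linear_combination ha | linear_combination hb | linear_combination h | aesop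

end PlaneMatrix

section Lorentz

variable {n : ℕ} {a b : Fin (n + 1)}

lemma planeMatrix_mem_lorentzO_of_ne_zero (ha : a ≠ 0) (hb : b ≠ 0) (hab : a ≠ b) {c s : ℝ}
    (h : c ^ 2 + s ^ 2 = 1) : planeMatrix a b c (-s) s ∈ lorentzO n := by
  refine planeMatrix_transpose_mul_diagonal_mul hab _ ?_ ?_ ?_ <;> simp [ha, hb] <;>
    linear_combination h

lemma planeMatrix_mem_lorentzO_zero (ha : a ≠ 0) {c s : ℝ}
    (h : c ^ 2 - s ^ 2 = 1) : planeMatrix 0 a c s s ∈ lorentzO n := by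
  refine planeMatrix_transpose_mul_diagonal_mul ha.symm _ ?_ ?_ ?_ <;> simp [ha]
  · linear_combination -h
  · linear_combination h

lemma mem_lorentzSO0_of_path {γ : ℝ → Matrix (Fin (n + 1)) (Fin (n + 1)) ℝ}
    (hγ : Continuous γ) (h0 : γ 0 = 1) (hO : ∀ t, γ t ∈ lorentzO n) (t : ℝ) :
    γ t ∈ lorentzSO0 n :=
  (isPreconnected_range hγ).subset_connectedComponentIn ⟨0, h0⟩
    (Set.range_subset_iff.2 hO) ⟨t, rfl⟩

/-- Half turns of spatial coordinate planes lie in `SO⁰(1,n)`. -/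
lemma halfTurn_mem_lorentzSO0 (ha : a ≠ 0) (hb : b ≠ 0) (hab : a ≠ b) :
    planeMatrix a b (-1) 0 0 ∈ lorentzSO0 n := by
  have := mem_lorentzSO0_of_path (n := n)
    (continuous_planeMatrix a b Real.continuous_cos Real.continuous_sin.neg Real.continuous_sin)
    (by simp [planeMatrix_one_zero_zero hab])
    (fun t => planeMatrix_mem_lorentzO_of_ne_zero ha hb hab (Real.cos_sq_add_sin_sq t)) Real.pi
  simpa using this

/-- Boosts along spatial coordinate axes lie in `SO⁰(1,n)`. -/
lemma boost_mem_lorentzSO0 (ha : a ≠ 0) {c s : ℝ} (hc : 0 ≤ c) (h : c ^ 2 - s ^ 2 = 1) :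
    planeMatrix 0 a c s s ∈ lorentzSO0 n := by
  have := mem_lorentzSO0_of_path (n := n) (γ := fun t => planeMatrix 0 a (√(1 + t ^ 2)) t t)
    (continuous_planeMatrix 0 a (by fun_prop) continuous_id continuous_id)
    (by simp [planeMatrix_one_zero_zero ha.symm])
    (fun t => planeMatrix_mem_lorentzO_zero ha (by rw [Real.sq_sqrt (by positivity)]; ring)) s
  rwa [show 1 + s ^ 2 = c ^ 2 by linarith, Real.sqrt_sq hc] at this

lemma exists_ne_zero_ne_ne (hn : 3 ≤ n) (x y : Fin (n + 1)) : ∃ m, m ≠ 0 ∧ m ≠ x ∧ m ≠ y := by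
  obtain ⟨m, hm⟩ := Finset.exists_mem_notMem_of_card_lt_card
    (s := {0, x, y}) (t := (Finset.univ : Finset (Fin (n + 1))))
    (lt_of_le_of_lt Finset.card_le_three (by simp; omega))
  exact ⟨m, by simpa using hm⟩

variable {f : (Fin (n + 1) → ℝ) →ₗ[ℝ] (Fin (n + 1) → ℝ) →ₗ[ℝ] (Fin (n + 1) → ℝ)}
  (hf : ∀ g ∈ lorentzSO0 n, ∀ x y, f (g *ᵥ x) (g *ᵥ y) = g *ᵥ f x y)

include hf

lemma equivariant_coeff_eq_zero_of_halfTurn (ha : a ≠ 0) (hb : b ≠ 0) (hab : a ≠ b)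
    {i j k : Fin (n + 1)}
    (h : (if i = a ∨ i = b then -1 else 1 : ℝ) * (if j = a ∨ j = b then -1 else 1) *
      (if k = a ∨ k = b then -1 else 1) = -1) :
    f (Pi.single i 1) (Pi.single j 1) k = 0 := by
  set s : Fin (n + 1) → ℝ := fun i => if i = a ∨ i = b then -1 else 1 with hs
  have hact : ∀ v k, (planeMatrix a b (-1) 0 0 *ᵥ v) k = s k * v k := by
    intro v k
    rw [planeMatrix_mulVec_apply hab]
    by_cases hka : k = a
    · simp [hs, hka]
    by_cases hkb : k = b
    · simp [hs, hkb, hab.symm]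
    · simp [hs, hka, hkb]
  have hsingle : ∀ i, planeMatrix a b (-1) 0 0 *ᵥ Pi.single i 1 =
      s i • (Pi.single i 1 : Fin (n + 1) → ℝ) := by
    intro i
    ext k
    rw [hact, Pi.smul_apply, smul_eq_mul]
    by_cases hki : k = i
    · rw [hki]
    · simp [hki]
  have hsq : ∀ i, s i * s i = 1 := by
    intro i
    simp only [hs]
    split_ifs <;> norm_num
  have e := congrFun (hf _ (halfTurn_mem_lorentzSO0 ha hb hab) (Pi.single i 1) (Pi.single j 1)) k
  rw [hsingle, hsingle, hact] at e
  simp only [map_smul, LinearMap.smul_apply, Pi.smul_apply, smul_eq_mul] at e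
  replace h : s i * s j * s k = -1 := h
  linear_combination (-1 / 2 * s k) * e +
    (f (Pi.single i 1) (Pi.single j 1) k / 2) * (h - hsq k)

lemma equivariant_coeff_boost (ha : a ≠ 0) (hb : b ≠ 0) (hab : a ≠ b)
    {i j k : Fin (n + 1)} (hi : i = 0 ∨ i = a) (hj : j = 0 ∨ j = a) (hk : k = 0 ∨ k = a) :
    f (Pi.single i 1) (Pi.single j 1) k = 0 := by
  have odd : ∀ i j k : Fin (n + 1), i = a ∧ j = 0 ∧ k = 0 ∨ i = 0 ∧ j = a ∧ k = 0 ∨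
      i = 0 ∧ j = 0 ∧ k = a ∨ i = a ∧ j = a ∧ k = a →
      f (Pi.single i 1) (Pi.single j 1) k = 0 := by
    intro i j k h
    refine equivariant_coeff_eq_zero_of_halfTurn hf ha hb hab ?_
    rcases h with ⟨rfl, rfl, rfl⟩ | ⟨rfl, rfl, rfl⟩ | ⟨rfl, rfl, rfl⟩ | ⟨rfl, rfl, rfl⟩ <;>
      simp [ha.symm, hb.symm]
  have o1 := odd a 0 0 (by simp)
  have o2 := odd 0 a 0 (by simp)
  have o3 := odd 0 0 a (by simp)
  have o4 := odd a a a (by simp)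
  have boost : ∀ c s : ℝ, 0 ≤ c → c ^ 2 - s ^ 2 = 1 → ∀ x y,
      f (planeMatrix 0 a c s s *ᵥ x) (planeMatrix 0 a c s s *ᵥ y) =
        planeMatrix 0 a c s s *ᵥ f x y :=
    fun c s hc h => hf _ (boost_mem_lorentzSO0 ha hc h)
  have b1 := boost (5 / 4) (3 / 4) (by norm_num) (by norm_num)
  have b2 := boost (5 / 3) (4 / 3) (by norm_num) (by norm_num)
  have e1 := congrFun (b1 (Pi.single 0 1) (Pi.single 0 1)) a
  have e2 := congrFun (b2 (Pi.single 0 1) (Pi.single 0 1)) a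
  have e3 := congrFun (b1 (Pi.single 0 1) (Pi.single 0 1)) 0
  have e4 := congrFun (b1 (Pi.single 0 1) (Pi.single a 1)) 0
  have e5 := congrFun (b1 (Pi.single a 1) (Pi.single 0 1)) 0
  simp only [planeMatrix_mulVec_single_left, planeMatrix_mulVec_single_right ha.symm,
    planeMatrix_mulVec_apply ha.symm, map_add, map_smul, LinearMap.add_apply,
    LinearMap.smul_apply, Pi.add_apply, Pi.smul_apply, smul_eq_mul, if_true, if_neg ha,
    o1, o2, o3, o4] at e1 e2 e3 e4 e5
  rcases hi with rfl | rfl <;> rcases hj with rfl | rfl <;> rcases hk with rfl | rfl <;> linarith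

lemma equivariant_coeff_eq_zero_of_mem_pair (hn : 3 ≤ n) {i j k : Fin (n + 1)}
    (hi : i = 0 ∨ i = a) (hj : j = 0 ∨ j = a) (hk : k = 0 ∨ k = a) :
    f (Pi.single i 1) (Pi.single j 1) k = 0 := by
  obtain ⟨c, hc, haa⟩ : ∃ c : Fin (n + 1), c ≠ 0 ∧ (a = 0 ∨ a = c) := by
    by_cases h : a = 0
    · obtain ⟨m, hm, -⟩ := exists_ne_zero_ne_ne hn 0 0
      exact ⟨m, hm, .inl h⟩
    · exact ⟨a, h, .inr rfl⟩
  obtain ⟨b, hb, hba, -⟩ := exists_ne_zero_ne_ne hn c c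
  have mem : ∀ {i}, i = 0 ∨ i = a → i = 0 ∨ i = c := by
    rintro i (h | h)
    · exact .inl h
    · rwa [h]
  exact equivariant_coeff_boost hf hc hb hba.symm (mem hi) (mem hj) (mem hk)

/-- A spatial index occurring an odd number of times can be paired with an absent one. -/
lemma equivariant_coeff_eq_zero_of_odd {m : Fin (n + 1)} (ha : a ≠ 0) (hm : m ≠ 0) (hma : m ≠ a)
    {i j k : Fin (n + 1)} (hi : m ≠ i) (hj : m ≠ j) (hk : m ≠ k)
    (h : (if i = a then -1 else 1 : ℝ) * (if j = a then -1 else 1) *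
      (if k = a then -1 else 1) = -1) :
    f (Pi.single i 1) (Pi.single j 1) k = 0 := by
  refine equivariant_coeff_eq_zero_of_halfTurn hf ha hm hma.symm ?_
  simpa only [hi.symm, hj.symm, hk.symm, or_false] using h

lemma equivariant_coeff_eq_zero_of_mem_triple (hn : 3 ≤ n) (x y : Fin (n + 1))
    {i j k : Fin (n + 1)} (hi : i = 0 ∨ i = x ∨ i = y) (hj : j = 0 ∨ j = x ∨ j = y)
    (hk : k = 0 ∨ k = x ∨ k = y) : f (Pi.single i 1) (Pi.single j 1) k = 0 := by
  by_cases hx : x = 0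
  · subst hx
    simp only [or_self_left] at hi hj hk
    exact equivariant_coeff_eq_zero_of_mem_pair hf hn hi hj hk
  by_cases hxy : x = y
  · subst hxy
    simp only [or_self] at hi hj hk
    exact equivariant_coeff_eq_zero_of_mem_pair hf hn hi hj hk
  by_cases hy : y = 0
  · subst hy
    simp only [or_comm (b := _ = (0 : Fin (n + 1))), or_self_left] at hi hj hk
    exact equivariant_coeff_eq_zero_of_mem_pair hf hn hi hj hk
  have hyx := Ne.symm hxy
  have hx' := Ne.symm hx
  obtain ⟨m, hm, hmx, hmy⟩ := exists_ne_zero_ne_ne hn x y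
  have pair_x := @equivariant_coeff_eq_zero_of_mem_pair n x f hf hn
  have pair_y := @equivariant_coeff_eq_zero_of_mem_pair n y f hf hn
  have odd_x := @equivariant_coeff_eq_zero_of_odd n x f hf m hx hm hmx
  have odd_y := @equivariant_coeff_eq_zero_of_odd n y f hf m hy hm hmy
  rcases hi with hi | hi | hi <;> rcases hj with hj | hj | hj <;>
    rcases hk with hk | hk | hk <;> rw [hi, hj, hk] <;>
    first
    | exact pair_x (by simp only [true_or, or_true]) (by simp only [true_or, or_true])
        (by simp only [true_or, or_true])
    | exact pair_y (by simp only [true_or, or_true]) (by simp only [true_or, or_true])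
        (by simp only [true_or, or_true])
    | (refine odd_x (by assumption) (by assumption) (by assumption) ?_
       simp only [hx', hyx, if_true, if_false]
       norm_num
       done)
    | (refine odd_y (by assumption) (by assumption) (by assumption) ?_
       simp only [hxy, if_true, if_false]
       norm_num)

lemma equivariant_coeff_eq_zero (hn : 3 ≤ n) (i j k : Fin (n + 1)) :
    f (Pi.single i 1) (Pi.single j 1) k = 0 := by
  by_cases hi : i = 0
  · exact equivariant_coeff_eq_zero_of_mem_triple hf hn j k (by simp [hi]) (by simp) (by simp)
  by_cases hij : i = j
  · exact equivariant_coeff_eq_zero_of_mem_triple hf hn j k (by simp [hij]) (by simp) (by simp)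
  by_cases hik : i = k
  · exact equivariant_coeff_eq_zero_of_mem_triple hf hn j k (by simp [hik]) (by simp) (by simp)
  by_cases hj : j = 0
  · exact equivariant_coeff_eq_zero_of_mem_triple hf hn i k (by simp) (by simp [hj]) (by simp)
  by_cases hk : k = 0
  · exact equivariant_coeff_eq_zero_of_mem_triple hf hn i j (by simp) (by simp) (by simp [hk])
  have h0 := equivariant_coeff_eq_zero_of_mem_triple hf hn j k (i := 0) (j := j) (k := k)
    (by simp) (by simp) (by simp)
  have e := congrFun (hf _ (boost_mem_lorentzSO0 hi (c := 5 / 4) (s := 3 / 4) (by norm_num)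
    (by norm_num)) (Pi.single i 1) (Pi.single j 1)) k
  rw [planeMatrix_mulVec_single_right (Ne.symm hi),
    planeMatrix_mulVec_single_of_ne _ _ _ hj (Ne.symm hij),
    planeMatrix_mulVec_apply (Ne.symm hi), if_neg hk, if_neg (Ne.symm hik)] at e
  simp only [map_add, map_smul, LinearMap.add_apply, LinearMap.smul_apply, Pi.add_apply,
    Pi.smul_apply, smul_eq_mul, h0] at e
  linarith

lemma equivariant_bilinear_eq_zero (hn : 3 ≤ n) : f = 0 := by
  refine LinearMap.pi_ext' fun i => LinearMap.ext_ring ?_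
  refine LinearMap.pi_ext' fun j => LinearMap.ext_ring ?_
  ext k
  simpa using equivariant_coeff_eq_zero hf hn i j k

end Lorentz

lemma piScalarRight_actV (n : ℕ) (g : Matrix (Fin (n + 1)) (Fin (n + 1)) ℝ)
    (w : (Fin (n + 1) → ℝ) ⊗[ℝ] (Fin 4 → ℝ)) (r : Fin 4) :
    TensorProduct.piScalarRight ℝ ℝ (Fin (n + 1) → ℝ) (Fin 4) (actV n g w) r =
      g *ᵥ TensorProduct.piScalarRight ℝ ℝ (Fin (n + 1) → ℝ) (Fin 4) w r := by
  induction w with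
  | zero => simp
  | tmul x y => simp [actV, Matrix.mulVec_smul]
  | add x y hx hy =>
    rw [map_add, map_add, map_add, Pi.add_apply, Pi.add_apply, hx, hy, Matrix.mulVec_add]

/-- For `n ≥ 3`, every `SO⁰(1,n)`-equivariant bilinear map
`β : V × V → V` on `V = ℝ^{n+1} ⊗ ℝ⁴`, where `g` acts by `g ⊗ id`, vanishes. -/
theorem bilinear_equivariant_vanishes (n : ℕ) (hn : 3 ≤ n)
    (β : ((Fin (n + 1) → ℝ) ⊗[ℝ] (Fin 4 → ℝ)) →ₗ[ℝ]
      ((Fin (n + 1) → ℝ) ⊗[ℝ] (Fin 4 → ℝ)) →ₗ[ℝ]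
      ((Fin (n + 1) → ℝ) ⊗[ℝ] (Fin 4 → ℝ)))
    (hβ : ∀ g ∈ lorentzSO0 n, ∀ x y,
      β (actV n g x) (actV n g y) = actV n g (β x y)) :
    β = 0 := by
  have key : ∀ (u v : Fin (n + 1) → ℝ) (p q : Fin 4 → ℝ), β (u ⊗ₜ p) (v ⊗ₜ q) = 0 := by
    intro u v p q
    apply (TensorProduct.piScalarRight ℝ ℝ (Fin (n + 1) → ℝ) (Fin 4)).injective
    ext1 r
    let ρ : (Fin (n + 1) → ℝ) ⊗[ℝ] (Fin 4 → ℝ) →ₗ[ℝ] (Fin (n + 1) → ℝ) :=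
      LinearMap.proj r ∘ₗ
        (TensorProduct.piScalarRight ℝ ℝ (Fin (n + 1) → ℝ) (Fin 4)).toLinearMap
    let f : (Fin (n + 1) → ℝ) →ₗ[ℝ] (Fin (n + 1) → ℝ) →ₗ[ℝ] (Fin (n + 1) → ℝ) :=
      (β.compl₁₂ ((TensorProduct.mk ℝ _ _).flip p) ((TensorProduct.mk ℝ _ _).flip q)).compr₂ ρ
    have hf : f = 0 := by
      refine equivariant_bilinear_eq_zero (fun g hg x y => ?_) hn
      have := congrArg ρ (hβ g hg (x ⊗ₜ p) (y ⊗ₜ q))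
      exact this.trans (piScalarRight_actV n g _ r)
    exact (LinearMap.congr_fun₂ hf u v).trans (by simp)
  refine TensorProduct.ext' fun u p => TensorProduct.ext' fun v q => ?_
  exact key u v p q
end
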